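/- There exists N ∈ ℕ, depending only on B and w₁, …, w_r, such that every element of C¹ can be written as a finite ℤ-linear combination of elements of C¹, each of which is supported on some finite nonempty subtree of T with at most N vertices. -/

import Mathlib

open scoped BigOperators

namespace DecompPaper

variable (B : Type) [DecidableEq B]

/-- The set of letters `B ⊔ B⁻¹` carries the discrete topology. -/
instance : TopologicalSpace (B × Bool) := ⊥

/-- The Gromov boundary `∂F` of the free group on `B`: the space of infinite reduced
words, i.e. sequences of letters with no cancelling adjacent pair, topologized as a
subspace of the product of discrete spaces. -/
abbrev Boundary : Type :=
  {s : ℕ → B × Bool // ∀ k, s (k + 1) ≠ ((s k).1, !(s k).2)}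

/-- The prefix of length `m` of an infinite reduced word, as an element of the free group. -/
def prefixOf (ξ : Boundary B) (m : ℕ) : FreeGroup B :=
  FreeGroup.mk (List.ofFn fun i : Fin m => ξ.1 i)

/-- Adjacency in the Cayley graph `T` of the free group with respect to `B`. -/
def Adj (g h : FreeGroup B) : Prop :=
  ∃ x : B × Bool, h = g * FreeGroup.mk [x]

/-- A set of vertices of `T` is a subtree iff any two of its vertices are joined by a
path in the Cayley graph staying inside the set. -/
def IsSubtree (X : Set (FreeGroup B)) : Prop :=
  ∀ g ∈ X, ∀ h ∈ X, Relation.ReflTransGen (fun a b => Adj B a b ∧ b ∈ X) g h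

/-- `C` is a connected component of `T ∖ X`. -/
def IsComponentOf (X C : Set (FreeGroup B)) : Prop :=
  ∃ v, v ∉ X ∧
    C = {u | Relation.ReflTransGen (fun a b => Adj B a b ∧ a ∉ X ∧ b ∉ X) v u}

/-- `∂C`: the set of boundary points all of whose sufficiently long prefixes lie in `C`. -/
def boundaryOf (C : Set (FreeGroup B)) : Set (Boundary B) :=
  {ξ | ∃ m, ∀ k, m ≤ k → prefixOf B ξ k ∈ C}

/-- The sequence `a` of group elements converges to the boundary point `ξ`:
every prefix of `ξ` is eventually an initial segment of the reduced word of `a k`. -/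
def TendstoBoundary (a : ℕ → FreeGroup B) (ξ : Boundary B) : Prop :=
  ∀ m : ℕ, ∃ K, ∀ k, K ≤ k → (List.ofFn fun i : Fin m => ξ.1 i) <+: (a k).toWord

/-- `{ξ, η}` is a line of the line pattern generated by the words `w i`: for some
`g` and `i`, `ξ` and `η` are the limits of `g * (w i) ^ k` as `k → +∞` and `k → -∞`
(in one of the two orders). -/
def IsLine {r : ℕ} (w : Fin r → FreeGroup B) (ξ η : Boundary B) : Prop :=
  ∃ (g : FreeGroup B) (i : Fin r),
    (TendstoBoundary B (fun k => g * w i ^ k) ξ ∧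
       TendstoBoundary B (fun k => g * (w i)⁻¹ ^ k) η) ∨
    (TendstoBoundary B (fun k => g * w i ^ k) η ∧
       TendstoBoundary B (fun k => g * (w i)⁻¹ ^ k) ξ)

/-- Malnormality of the family of cyclic subgroups `⟨w i⟩`. -/
def Malnormal {r : ℕ} (w : Fin r → FreeGroup B) : Prop :=
  ∀ (g : FreeGroup B) (i j : Fin r),
    (∃ x : FreeGroup B, x ∈ Subgroup.zpowers (w i) ∧ x ≠ 1 ∧
        g * x * g⁻¹ ∈ Subgroup.zpowers (w j)) →
      i = j ∧ g ∈ Subgroup.zpowers (w i)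

/-- The decomposition space `D`: the quotient of `∂F` by the smallest equivalence
relation identifying the two endpoints of each line, with the quotient topology. -/
abbrev DSpace {r : ℕ} (w : Fin r → FreeGroup B) : Type :=
  Quot (IsLine B w)

/-- The quotient projection `q : ∂F → D`. -/
def qmap {r : ℕ} (w : Fin r → FreeGroup B) : Boundary B → DSpace B w :=
  Quot.mk _

/-- The geodesic of the line with endpoints `ξ` and `η`: all prefixes of `ξ` or of `η`
of length at least the length of their longest common initial segment. -/
def lineGeodesic (ξ η : Boundary B) : Set (FreeGroup B) :=
  {g | ∃ k : ℕ, (g = prefixOf B ξ k ∨ g = prefixOf B η k) ∧ ∃ i ≤ k, ξ.1 i ≠ η.1 i}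

/-- The line with endpoints `ξ, η` passes through the subtree `X`. -/
def PassesThrough (ξ η : Boundary B) (X : Set (FreeGroup B)) : Prop :=
  ∃ g ∈ X, g ∈ lineGeodesic B ξ η

/-- A function `σ : D → ℤ` is supported on the subtree `X` if `σ ∘ q` is constant on
`∂C` for every connected component `C` of `T ∖ X`. -/
def SupportedOn {r : ℕ} (w : Fin r → FreeGroup B) (σ : DSpace B w → ℤ)
    (X : Set (FreeGroup B)) : Prop :=
  ∀ C : Set (FreeGroup B), IsComponentOf B X C →
    ∀ ξ, ξ ∈ boundaryOf B C → ∀ η, η ∈ boundaryOf B C →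
      σ (qmap B w ξ) = σ (qmap B w η)

/-- Prepending a letter to an infinite reduced word, cancelling if necessary. -/
def consB (x : B × Bool) (ξ : Boundary B) : Boundary B :=
  if h : ξ.1 0 = (x.1, !x.2) then
    ⟨fun k => ξ.1 (k + 1), fun k => ξ.2 (k + 1)⟩
  else
    ⟨fun k => Nat.rec x (fun j _ => ξ.1 j) k, by
      intro k
      cases k with
      | zero => exact h
      | succ j => exact ξ.2 j⟩

/-- The action of the free group on its boundary: left multiplication followed by
reduction. -/
def actB (g : FreeGroup B) (ξ : Boundary B) : Boundary B :=
  g.toWord.foldr (consB B) ξ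

/-- The induced action of the free group on the decomposition space. -/
noncomputable def actD {r : ℕ} (w : Fin r → FreeGroup B) (g : FreeGroup B)
    (x : DSpace B w) : DSpace B w :=
  qmap B w (actB B g (Quot.out x))

/-- The map `p : (ℤ[F])^k → C(D, ℤ)` of right `ℤ[F]`-modules determined by generators
`σ j`, where an element of the free module `(ℤ[F])^k` is recorded as a finitely
supported function `(Fin k × F) →₀ ℤ` and `e_j · g` is sent to `σ j · g`. -/
noncomputable def pMap {r : ℕ} (w : Fin r → FreeGroup B) {k : ℕ}
    (σ : Fin k → DSpace B w → ℤ) (x : (Fin k × FreeGroup B) →₀ ℤ) :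
    DSpace B w → ℤ :=
  fun d => x.sum fun p n => n * σ p.1 (actD B w p.2 d)

/-- Right translation by `g` on the free module `(ℤ[F])^k`, sending `e_j · h` to
`e_j · (h * g)`. -/
noncomputable def fsTranslate {k : ℕ} (y : (Fin k × FreeGroup B) →₀ ℤ)
    (g : FreeGroup B) : (Fin k × FreeGroup B) →₀ ℤ :=
  Finsupp.mapDomain (fun p => (p.1, p.2 * g)) y

/-- The convex hull of a set of vertices of `T`: the smallest subtree containing it. -/
def hull (S : Set (FreeGroup B)) : Set (FreeGroup B) :=
  ⋂₀ {Y : Set (FreeGroup B) | IsSubtree B Y ∧ S ⊆ Y}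

/-- The support of an element of the free module `(ℤ[F])^k`, relative to supports
`X j` of the generators: the convex hull of the union of the sets `g⁻¹ • X j` over
the pairs `(j, g)` appearing with nonzero coefficient. -/
def fsSupport {k : ℕ} (X : Fin k → Set (FreeGroup B))
    (x : (Fin k × FreeGroup B) →₀ ℤ) : Set (FreeGroup B) :=
  hull B (⋃ p ∈ x.support, (fun v => p.2⁻¹ * v) '' X p.1)

/-- Antisymmetry of a `1`-cochain on oriented lines. -/
def Antisym {r : ℕ} (w : Fin r → FreeGroup B)
    (f : Boundary B → Boundary B → ℤ) : Prop :=
  ∀ ξ η, IsLine B w ξ η → f η ξ = -f ξ η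

/-- A `1`-cochain is supported on the subtree `X`: it vanishes on lines not passing
through `X`, and depends only on the pair of components of `T ∖ X` containing the two
endpoints. -/
def SupportedOn1 {r : ℕ} (w : Fin r → FreeGroup B)
    (f : Boundary B → Boundary B → ℤ) (X : Set (FreeGroup B)) : Prop :=
  (∀ ξ η, IsLine B w ξ η → ¬PassesThrough B ξ η X → f ξ η = 0) ∧
  (∀ C C' : Set (FreeGroup B), IsComponentOf B X C → IsComponentOf B X C' → C ≠ C' →
    ∀ ξ ξ' η η', IsLine B w ξ η → IsLine B w ξ' η' →
      ξ ∈ boundaryOf B C → ξ' ∈ boundaryOf B C →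
      η ∈ boundaryOf B C' → η' ∈ boundaryOf B C' →
      f ξ η = f ξ' η')

/-- Membership in `C¹`: an antisymmetric integer-valued function on oriented lines
supported on at least one finite nonempty subtree of `T`. -/
def MemC1 {r : ℕ} (w : Fin r → FreeGroup B)
    (f : Boundary B → Boundary B → ℤ) : Prop :=
  Antisym B w f ∧
    ∃ X : Set (FreeGroup B), X.Finite ∧ X.Nonempty ∧ IsSubtree B X ∧
      SupportedOn1 B w f X

/-- The ball of radius `R` about a set `Y` of vertices of `T` (word metric). -/
def ballAbout (Y : Set (FreeGroup B)) (R : ℕ) : Set (FreeGroup B) :=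
  {g | ∃ y ∈ Y, (y⁻¹ * g).toWord.length ≤ R}

/-- The map `p : (ℤ[F])^k → C¹` of right `ℤ[F]`-modules determined by generators
`f j`, sending `e_j · g` to `f j · g`. -/
noncomputable def pC1 {k : ℕ} (f : Fin k → Boundary B → Boundary B → ℤ)
    (x : (Fin k × FreeGroup B) →₀ ℤ) : Boundary B → Boundary B → ℤ :=
  fun ξ η => x.sum fun p n => n * f p.1 (actB B p.2 ξ) (actB B p.2 η)

/-- `σ : ∂F → ℤ` is constant on `∂C` for every connected component `C` of `T ∖ X`. -/
def ConstOnComponents (X : Set (FreeGroup B)) (σ : Boundary B → ℤ) : Prop :=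
  ∀ C : Set (FreeGroup B), IsComponentOf B X C →
    ∀ ξ, ξ ∈ boundaryOf B C → ∀ η, η ∈ boundaryOf B C → σ ξ = σ η

/-- The shadow `S(g) ⊆ ∂F` of a nontrivial group element `g`: the boundary points
having the reduced word of `g` as an initial segment. -/
def shadow (g : FreeGroup B) : Set (Boundary B) :=
  {ξ | prefixOf B ξ g.toWord.length = g}

end DecompPaper

namespace DecompPaper

open FreeGroup

variable {B : Type}

/-- The formal inverse of a letter. -/
def invLetter (x : B × Bool) : B × Bool := (x.1, !x.2)

@[simp] lemma invLetter_invLetter (x : B × Bool) : invLetter (invLetter x) = x := by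
  simp [invLetter]

lemma mk_invLetter (x : B × Bool) : FreeGroup.mk [invLetter x] = (FreeGroup.mk [x])⁻¹ := by
  simp [invLetter, FreeGroup.inv_mk, FreeGroup.invRev]

lemma Boundary.succ_ne (ξ : Boundary B) (k : ℕ) : ξ.1 (k + 1) ≠ invLetter (ξ.1 k) := ξ.2 k

lemma prefixOf_zero (ξ : Boundary B) : prefixOf B ξ 0 = 1 := rfl

lemma Boundary.ext_apply {ξ η : Boundary B} (h : ∀ k, ξ.1 k = η.1 k) : ξ = η :=
  Subtype.ext (funext h)

section Words

variable [DecidableEq B]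

lemma toWord_letter_mul_of_head (x : B × Bool) (g : FreeGroup B)
    (h : g.toWord.head? = some (invLetter x)) :
    (FreeGroup.mk [x] * g).toWord = g.toWord.tail := by
  rw [toWord_mul, toWord_mk, reduce_singleton, List.singleton_append, reduce.cons, reduce_toWord]
  cases hg : g.toWord with
  | nil => simp [hg] at h
  | cons y t =>
    have hy : y = invLetter x := by simpa [hg] using h
    simp [hy, invLetter]

lemma toWord_letter_mul_of_head_ne (x : B × Bool) (g : FreeGroup B)
    (h : g.toWord.head? ≠ some (invLetter x)) :
    (FreeGroup.mk [x] * g).toWord = x :: g.toWord := by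
  rw [toWord_mul, toWord_mk, reduce_singleton, List.singleton_append, reduce.cons, reduce_toWord]
  cases hg : g.toWord with
  | nil => rfl
  | cons y t =>
    have hy : ¬(x.1 = y.1 ∧ x.2 = !y.2) := by
      rintro ⟨h1, h2⟩
      apply h
      rw [hg, List.head?_cons]
      congr 1
      exact Prod.ext h1.symm (by simp [invLetter, h2])
    simp [hy]

lemma head_toWord_mul_letter (y : B × Bool) (v : FreeGroup B) (hv : v ≠ 1)
    (hvy : v * FreeGroup.mk [y] ≠ 1) :
    (v * FreeGroup.mk [y]).toWord.head? = v.toWord.head? := by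
  obtain ⟨L, hL⟩ : ∃ L, v.toWord = L := ⟨_, rfl⟩
  induction L generalizing v with
  | nil => exact absurd (toWord_eq_nil_iff.1 hL) hv
  | cons x t ih =>
    have hred : IsReduced (x :: t) := hL ▸ isReduced_toWord
    have ht : (FreeGroup.mk t).toWord = t := by
      rw [toWord_mk]
      exact (hred.infix (List.suffix_cons x t).isInfix).reduce_eq
    have hvt : v = FreeGroup.mk [x] * FreeGroup.mk t := by
      rw [← mk_toWord (x := v), hL, FreeGroup.mul_mk, List.singleton_append]
    rw [hL, List.head?_cons]
    rw [hvt, mul_assoc] at hvy ⊢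
    by_cases h1 : FreeGroup.mk t * FreeGroup.mk [y] = 1
    · rw [h1, mul_one, toWord_mk, reduce_singleton, List.head?_cons]
    · rw [toWord_letter_mul_of_head_ne, List.head?_cons]
      intro hc
      by_cases h2 : FreeGroup.mk t = 1
      · rw [h2, one_mul, toWord_mk, reduce_singleton, List.head?_cons, Option.some_inj] at hc
        rw [h2, one_mul, hc, mk_invLetter, mul_inv_cancel] at hvy
        exact hvy rfl
      · rw [ih _ h2 h1 ht, ht] at hc
        cases t with
        | nil => simp at hc
        | cons z t =>
          rw [List.head?_cons, Option.some_inj] at hc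
          have := (isReduced_cons_cons.1 hred).1
          simp [hc, invLetter] at this

end Words

section Prefixes

variable [DecidableEq B]

lemma toWord_prefixOf (ξ : Boundary B) (m : ℕ) :
    (prefixOf B ξ m).toWord = List.ofFn fun i : Fin m => ξ.1 i := by
  rw [prefixOf, toWord_mk]
  apply IsReduced.reduce_eq
  rw [FreeGroup.IsReduced, List.isChain_ofFn]
  intro i hi h1
  by_contra h2
  refine ξ.succ_ne i (Prod.ext h1.symm ?_)
  change (ξ.1 (i + 1)).2 = !(ξ.1 i).2
  have h3 : (ξ.1 i).2 ≠ (ξ.1 (i + 1)).2 := h2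
  revert h3
  cases (ξ.1 i).2 <;> cases (ξ.1 (i + 1)).2 <;> simp

lemma norm_prefixOf (ξ : Boundary B) (m : ℕ) : (prefixOf B ξ m).norm = m := by
  rw [FreeGroup.norm, toWord_prefixOf, List.length_ofFn]

lemma tendstoBoundary_iff {a : ℕ → FreeGroup B} {ξ : Boundary B} :
    TendstoBoundary B a ξ ↔
      ∀ m : ℕ, ∃ K, ∀ k, K ≤ k → ∀ i < m, (a k).toWord[i]? = some (ξ.1 i) := by
  unfold TendstoBoundary
  refine forall_congr' fun m => exists_congr fun K => forall_congr' fun k =>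
    imp_congr_right fun _ => ?_
  rw [List.prefix_iff_getElem?]
  simp

lemma tendstoBoundary_prefixOf (ξ : Boundary B) : TendstoBoundary B (prefixOf B ξ) ξ := by
  rw [tendstoBoundary_iff]
  intro m
  refine ⟨m, fun k hk i hi => ?_⟩
  rw [toWord_prefixOf, List.getElem?_ofFn, dif_pos (by omega)]

lemma TendstoBoundary.unique {a : ℕ → FreeGroup B} {ξ η : Boundary B}
    (hξ : TendstoBoundary B a ξ) (hη : TendstoBoundary B a η) : ξ = η := by
  rw [tendstoBoundary_iff] at hξ hη
  refine Boundary.ext_apply fun k => ?_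
  obtain ⟨K, hK⟩ := hξ (k + 1)
  obtain ⟨K', hK'⟩ := hη (k + 1)
  have h1 := hK (max K K') (le_max_left _ _) k k.lt_succ_self
  have h2 := hK' (max K K') (le_max_right _ _) k k.lt_succ_self
  simpa using h1.symm.trans h2

lemma TendstoBoundary.comp_succ {a : ℕ → FreeGroup B} {ξ : Boundary B}
    (h : TendstoBoundary B a ξ) : TendstoBoundary B (fun k => a (k + 1)) ξ := fun m => by
  obtain ⟨K, hK⟩ := h m
  exact ⟨K, fun k hk => hK (k + 1) (by omega)⟩

end Prefixes

section Action

variable [DecidableEq B]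

lemma consB_apply_of_eq {x : B × Bool} {ξ : Boundary B} (h : ξ.1 0 = invLetter x) (k : ℕ) :
    (consB B x ξ).1 k = ξ.1 (k + 1) := by
  rw [invLetter] at h
  rw [consB, dif_pos h]

lemma consB_apply_zero_of_ne {x : B × Bool} {ξ : Boundary B} (h : ξ.1 0 ≠ invLetter x) :
    (consB B x ξ).1 0 = x := by
  rw [invLetter] at h
  simp only [consB, dif_neg h, Nat.rec_zero]

lemma consB_apply_succ_of_ne {x : B × Bool} {ξ : Boundary B} (h : ξ.1 0 ≠ invLetter x) (k : ℕ) :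
    (consB B x ξ).1 (k + 1) = ξ.1 k := by
  rw [invLetter] at h
  rw [consB, dif_neg h]

lemma prefixOf_consB_of_ne {x : B × Bool} {ξ : Boundary B} (h : ξ.1 0 ≠ invLetter x) (k : ℕ) :
    prefixOf B (consB B x ξ) (k + 1) = FreeGroup.mk [x] * prefixOf B ξ k := by
  simp [prefixOf, List.ofFn_succ, FreeGroup.mul_mk, consB_apply_zero_of_ne h,
    consB_apply_succ_of_ne h]

lemma prefixOf_consB_of_eq {x : B × Bool} {ξ : Boundary B} (h : ξ.1 0 = invLetter x) (k : ℕ) :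
    prefixOf B (consB B x ξ) k = FreeGroup.mk [x] * prefixOf B ξ (k + 1) := by
  have : prefixOf B ξ (k + 1)
      = FreeGroup.mk [invLetter x] * prefixOf B (consB B x ξ) k := by
    simp [prefixOf, List.ofFn_succ, FreeGroup.mul_mk, consB_apply_of_eq h, h]
  rw [this, mk_invLetter, mul_inv_cancel_left]

lemma TendstoBoundary.consB {a : ℕ → FreeGroup B} {ξ : Boundary B}
    (h : TendstoBoundary B a ξ) (x : B × Bool) :
    TendstoBoundary B (fun k => FreeGroup.mk [x] * a k) (consB B x ξ) := by
  rw [tendstoBoundary_iff] at h ⊢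
  intro m
  obtain ⟨K, hK⟩ := h (m + 1)
  refine ⟨K, fun k hk i hi => ?_⟩
  have h0 : (a k).toWord.head? = some (ξ.1 0) := by
    rw [List.head?_eq_getElem?]
    exact hK k hk 0 (by omega)
  by_cases hx : ξ.1 0 = invLetter x
  · rw [toWord_letter_mul_of_head x _ (by rw [h0, hx]), consB_apply_of_eq hx, List.getElem?_tail]
    exact hK k hk (i + 1) (by omega)
  · rw [toWord_letter_mul_of_head_ne x _ (by rwa [h0, Ne, Option.some_inj])]
    cases i with
    | zero => rw [consB_apply_zero_of_ne hx, List.getElem?_cons_zero]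
    | succ i =>
      rw [consB_apply_succ_of_ne hx, List.getElem?_cons_succ]
      exact hK k hk i (by omega)

lemma TendstoBoundary.actB {a : ℕ → FreeGroup B} {ξ : Boundary B}
    (h : TendstoBoundary B a ξ) (g : FreeGroup B) :
    TendstoBoundary B (fun k => g * a k) (actB B g ξ) := by
  suffices H : ∀ L : List (B × Bool),
      TendstoBoundary B (fun k => FreeGroup.mk L * a k) (L.foldr (DecompPaper.consB B) ξ) by
    simpa [DecompPaper.actB, mk_toWord] using H g.toWord
  intro L
  induction L with
  | nil => simpa [← FreeGroup.one_eq_mk] using h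
  | cons x L ih =>
    simpa [← mul_assoc, FreeGroup.mul_mk] using ih.consB x

lemma actB_mul (g h : FreeGroup B) (ξ : Boundary B) :
    actB B (g * h) ξ = actB B g (actB B h ξ) := by
  refine ((tendstoBoundary_prefixOf ξ).actB (g * h)).unique ?_
  simpa only [mul_assoc] using ((tendstoBoundary_prefixOf ξ).actB h).actB g

lemma actB_one (ξ : Boundary B) : actB B 1 ξ = ξ := by
  simp [actB]

lemma actB_letter (x : B × Bool) (ξ : Boundary B) :
    actB B (FreeGroup.mk [x]) ξ = consB B x ξ := by
  simp [actB, toWord_mk]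

lemma actB_inv_actB (g : FreeGroup B) (ξ : Boundary B) : actB B g⁻¹ (actB B g ξ) = ξ := by
  rw [← actB_mul, inv_mul_cancel, actB_one]

lemma actB_actB_inv (g : FreeGroup B) (ξ : Boundary B) : actB B g (actB B g⁻¹ ξ) = ξ := by
  rw [← actB_mul, mul_inv_cancel, actB_one]

end Action

section Geodesics

lemma lineGeodesic_comm (ξ η : Boundary B) : lineGeodesic B ξ η = lineGeodesic B η ξ := by
  ext g
  simp only [lineGeodesic, Set.mem_ofPred_eq, ne_comm, or_comm]

lemma prefixOf_mem_lineGeodesic {ξ η : Boundary B} {i k : ℕ} (hik : i ≤ k)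
    (h : ξ.1 i ≠ η.1 i) : prefixOf B ξ k ∈ lineGeodesic B ξ η :=
  ⟨k, Or.inl rfl, i, hik, h⟩

/-- The sequence of letters read along the geodesic from `η` to `ξ`, indexed so that the
vertex `1` is passed just before the letter of index `0`. -/
def biWord (ξ η : Boundary B) : ℤ → B × Bool
  | Int.ofNat n => ξ.1 n
  | Int.negSucc n => invLetter (η.1 n)

lemma biWord_swap (ξ η : Boundary B) (n : ℤ) :
    biWord η ξ n = invLetter (biWord ξ η (-1 - n)) := by
  rcases n with n | n
  · have : -1 - Int.ofNat n = Int.negSucc n := by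
      rw [Int.negSucc_eq, Int.ofNat_eq_natCast]; ring
    rw [this]
    simp [biWord]
  · have : -1 - Int.negSucc n = Int.ofNat n := by
      rw [Int.negSucc_eq, Int.ofNat_eq_natCast]; ring
    rw [this]
    rfl

lemma periodic_biWord_swap {ξ η : Boundary B} {c : ℤ}
    (h : Function.Periodic (biWord ξ η) c) : Function.Periodic (biWord η ξ) c := by
  intro n
  rw [biWord_swap, biWord_swap ξ η n, ← h (-1 - (n + c))]
  congr 2
  ring

lemma prefixOf_mul_eq_pow {ξ : Boundary B} {l : ℕ} (h : ∀ k, ξ.1 (k + l) = ξ.1 k) (n : ℕ) :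
    prefixOf B ξ (n * l) = prefixOf B ξ l ^ n := by
  induction n with
  | zero => simp [prefixOf_zero]
  | succ n ih =>
    rw [pow_succ', ← ih, Nat.succ_mul, Nat.add_comm]
    simp only [prefixOf, FreeGroup.mul_mk, List.ofFn_add]
    congr 2
    refine congrArg List.ofFn (funext fun i => ?_)
    simp [Nat.add_comm l, h]

variable [DecidableEq B]

lemma letter_mul_mem_lineGeodesic (x : B × Bool) {ξ η : Boundary B} {h : FreeGroup B}
    (hh : h ∈ lineGeodesic B ξ η) :
    FreeGroup.mk [x] * h ∈ lineGeodesic B (consB B x ξ) (consB B x η) := by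
  suffices H : ∀ (ξ η : Boundary B) (k i : ℕ), i ≤ k → ξ.1 i ≠ η.1 i →
      FreeGroup.mk [x] * prefixOf B ξ k ∈ lineGeodesic B (consB B x ξ) (consB B x η) by
    obtain ⟨k, rfl | rfl, i, hik, hi⟩ := hh
    · exact H ξ η k i hik hi
    · rw [lineGeodesic_comm]
      exact H η ξ k i hik hi.symm
  intro ξ η k i hik hi
  by_cases hξ : ξ.1 0 = invLetter x
  · by_cases hη : η.1 0 = invLetter x
    · obtain ⟨j, rfl⟩ : ∃ j, i = j + 1 := by
        refine Nat.exists_eq_succ_of_ne_zero ?_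
        rintro rfl
        exact hi (hξ.trans hη.symm)
      obtain ⟨l, rfl⟩ : ∃ l, k = l + 1 := ⟨k - 1, by omega⟩
      rw [← prefixOf_consB_of_eq hξ]
      refine prefixOf_mem_lineGeodesic (i := j) (by omega) ?_
      rwa [consB_apply_of_eq hξ, consB_apply_of_eq hη]
    · have h0 : (consB B x ξ).1 0 ≠ (consB B x η).1 0 := by
        rw [consB_apply_of_eq hξ, consB_apply_zero_of_ne hη]
        intro hc
        have := ξ.succ_ne 0
        rw [hξ, invLetter_invLetter] at this
        exact this hc
      cases k with
      | zero =>
        rw [prefixOf_zero, ← prefixOf_zero η, ← prefixOf_consB_of_ne hη, lineGeodesic_comm]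
        exact prefixOf_mem_lineGeodesic (i := 0) (Nat.zero_le _) h0.symm
      | succ l =>
        rw [← prefixOf_consB_of_eq hξ]
        exact prefixOf_mem_lineGeodesic (i := 0) (Nat.zero_le _) h0
  · rw [← prefixOf_consB_of_ne hξ]
    by_cases hη : η.1 0 = invLetter x
    · refine prefixOf_mem_lineGeodesic (i := 0) (Nat.zero_le _) ?_
      rw [consB_apply_zero_of_ne hξ, consB_apply_of_eq hη]
      intro hc
      have := η.succ_ne 0
      rw [hη, invLetter_invLetter] at this
      exact this hc.symm
    · refine prefixOf_mem_lineGeodesic (i := i + 1) (by omega) ?_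
      rwa [consB_apply_succ_of_ne hξ, consB_apply_succ_of_ne hη]

lemma mul_mem_lineGeodesic (g : FreeGroup B) {ξ η : Boundary B} {h : FreeGroup B}
    (hh : h ∈ lineGeodesic B ξ η) : g * h ∈ lineGeodesic B (actB B g ξ) (actB B g η) := by
  suffices H : ∀ L : List (B × Bool), FreeGroup.mk L * h ∈
      lineGeodesic B (L.foldr (consB B) ξ) (L.foldr (consB B) η) by
    simpa [actB, mk_toWord] using H g.toWord
  intro L
  induction L with
  | nil => simpa [← FreeGroup.one_eq_mk] using hh
  | cons x L ih => simpa [← mul_assoc, FreeGroup.mul_mk] using letter_mul_mem_lineGeodesic x ih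

lemma one_mem_lineGeodesic_iff {ξ η : Boundary B} :
    1 ∈ lineGeodesic B ξ η ↔ ξ.1 0 ≠ η.1 0 := by
  constructor
  · rintro ⟨k, hk, i, hik, hi⟩
    have hk0 : k = 0 := by
      rcases hk with hk | hk <;> simpa [norm_prefixOf] using (congrArg FreeGroup.norm hk).symm
    obtain rfl : i = 0 := by omega
    exact hi
  · intro h
    rw [← prefixOf_zero ξ]
    exact prefixOf_mem_lineGeodesic le_rfl h

/-- A vertex lies on a geodesic iff, seen from it, the two endpoints lie in different
directions. -/
lemma mem_lineGeodesic_iff {a : FreeGroup B} {ξ η : Boundary B} :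
    a ∈ lineGeodesic B ξ η ↔ (actB B a⁻¹ ξ).1 0 ≠ (actB B a⁻¹ η).1 0 := by
  rw [← one_mem_lineGeodesic_iff]
  constructor
  · intro h
    simpa using mul_mem_lineGeodesic a⁻¹ h
  · intro h
    simpa [actB_actB_inv] using mul_mem_lineGeodesic a h

lemma head_ne_of_letter_inv {ξ η : Boundary B} (h : ξ.1 0 ≠ η.1 0) :
    (consB B (invLetter (ξ.1 0)) ξ).1 0 ≠ (consB B (invLetter (ξ.1 0)) η).1 0 := by
  rw [consB_apply_of_eq (by simp), consB_apply_zero_of_ne (by simpa using h.symm)]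
  exact ξ.succ_ne 0

lemma biWord_letter_inv {ξ η : Boundary B} (h : ξ.1 0 ≠ η.1 0) (n : ℤ) :
    biWord (consB B (invLetter (ξ.1 0)) ξ) (consB B (invLetter (ξ.1 0)) η) n =
      biWord ξ η (n + 1) := by
  rcases n with n | n
  · exact consB_apply_of_eq (by simp) n
  · cases n with
    | zero =>
      change invLetter ((consB B (invLetter (ξ.1 0)) η).1 0) = ξ.1 0
      rw [consB_apply_zero_of_ne (by simpa using h.symm), invLetter_invLetter]
    | succ n =>
      have : Int.negSucc (n + 1) + 1 = Int.negSucc n := by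
        simp only [Int.negSucc_eq]; push_cast; ring
      rw [this]
      change invLetter ((consB B (invLetter (ξ.1 0)) η).1 (n + 1)) = invLetter (η.1 n)
      rw [consB_apply_succ_of_ne (by simpa using h.symm)]

lemma biWord_prefixOf_inv {ξ η : Boundary B} (h : ξ.1 0 ≠ η.1 0) (l : ℕ) (n : ℤ) :
    biWord (actB B (prefixOf B ξ l)⁻¹ ξ) (actB B (prefixOf B ξ l)⁻¹ η) n =
      biWord ξ η (n + l) := by
  induction l generalizing ξ η with
  | zero => simp [prefixOf_zero, actB_one]
  | succ l ih =>
    have hp : (prefixOf B ξ (l + 1))⁻¹ =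
        (prefixOf B (consB B (invLetter (ξ.1 0)) ξ) l)⁻¹ * FreeGroup.mk [invLetter (ξ.1 0)] := by
      rw [prefixOf_consB_of_eq (by simp)]
      group
    rw [hp, actB_mul, actB_mul, actB_letter, actB_letter, ih (head_ne_of_letter_inv h),
      biWord_letter_inv h]
    congr 1
    push_cast
    ring

end Geodesics

section Periodicity

variable [DecidableEq B] {r : ℕ} {w : Fin r → FreeGroup B}

lemma IsLine.map_actB {ξ η : Boundary B} (h : IsLine B w ξ η) (a : FreeGroup B) :
    IsLine B w (actB B a ξ) (actB B a η) := by
  obtain ⟨g, i, h⟩ := h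
  refine ⟨a * g, i, ?_⟩
  simp only [mul_assoc]
  exact h.imp (fun h => ⟨h.1.actB a, h.2.actB a⟩) (fun h => ⟨h.1.actB a, h.2.actB a⟩)

lemma actB_conj_of_tendsto_pow {g v : FreeGroup B} {ξ : Boundary B}
    (h : TendstoBoundary B (fun k => g * v ^ k) ξ) : actB B (g * v * g⁻¹) ξ = ξ := by
  refine (h.actB (g * v * g⁻¹)).unique ?_
  convert h.comp_succ using 2 with k
  rw [pow_succ']
  group

lemma actB_inv_eq_self {g : FreeGroup B} {ξ : Boundary B} (h : actB B g ξ = ξ) :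
    actB B g⁻¹ ξ = ξ := by
  conv_lhs => rw [← h]
  exact actB_inv_actB g ξ

/-- The endpoints of a line are fixed by a conjugate of one of the generating words. -/
lemma IsLine.exists_conj_fixing {ξ η : Boundary B} (h : IsLine B w ξ η) :
    ∃ (g : FreeGroup B) (i : Fin r),
      actB B (g * w i * g⁻¹) ξ = ξ ∧ actB B (g * w i * g⁻¹) η = η := by
  have key : ∀ (g v : FreeGroup B) (ξ : Boundary B),
      TendstoBoundary B (fun k => g * v⁻¹ ^ k) ξ → actB B (g * v * g⁻¹) ξ = ξ := by
    intro g v ξ h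
    have := actB_inv_eq_self (actB_conj_of_tendsto_pow h)
    rwa [show (g * v⁻¹ * g⁻¹)⁻¹ = g * v * g⁻¹ by group] at this
  obtain ⟨g, i, ⟨h1, h2⟩ | ⟨h1, h2⟩⟩ := h
  · exact ⟨g, i, actB_conj_of_tendsto_pow h1, key _ _ _ h2⟩
  · exact ⟨g, i, key _ _ _ h2, actB_conj_of_tendsto_pow h1⟩

/-- The translation length of an element of the free group is at most the length of each of
its conjugates. -/
lemma le_norm_of_conj_eq_prefixOf {ξ : Boundary B} {l : ℕ} (h : ∀ k, ξ.1 (k + l) = ξ.1 k)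
    {g v : FreeGroup B} (hγ : g * v * g⁻¹ = prefixOf B ξ l) : l ≤ v.norm := by
  have hpow : ∀ n : ℕ, (v ^ n).norm ≤ n * v.norm := by
    intro n
    induction n with
    | zero => simp
    | succ n ih =>
      rw [pow_succ, Nat.succ_mul]
      exact (FreeGroup.norm_mul_le _ _).trans (by omega)
  by_contra! hlt
  set n := 2 * g.norm + 1 with hn
  have h1 : n * l ≤ g.norm + n * v.norm + g.norm := by
    rw [← norm_prefixOf ξ (n * l), prefixOf_mul_eq_pow h, ← hγ, conj_pow]
    have h2 := FreeGroup.norm_mul_le (g * v ^ n) g⁻¹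
    have h3 := FreeGroup.norm_mul_le g (v ^ n)
    have h4 := hpow n
    rw [norm_inv_eq] at h2
    omega
  have h5 : n * (v.norm + 1) ≤ n * l := Nat.mul_le_mul_left n hlt
  rw [Nat.mul_add] at h5
  omega

/-- A common period of all lines of the pattern generated by the words `w i`. -/
def commonPeriod (w : Fin r → FreeGroup B) : ℕ := (∑ i, (w i).norm).factorial

lemma commonPeriod_pos (w : Fin r → FreeGroup B) : 0 < commonPeriod w := Nat.factorial_pos _

lemma periodic_biWord_of_fixed {ξ η : Boundary B} (h0 : ξ.1 0 ≠ η.1 0) {g : FreeGroup B}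
    {i : Fin r} (hwi : w i ≠ 1) (hξ : actB B (g * w i * g⁻¹) ξ = ξ)
    (hη : actB B (g * w i * g⁻¹) η = η) {l : ℕ} (hγ : g * w i * g⁻¹ = prefixOf B ξ l) :
    Function.Periodic (biWord ξ η) (commonPeriod w) := by
  have hper : Function.Periodic (biWord ξ η) l := by
    intro n
    have := biWord_prefixOf_inv h0 l n
    rw [← hγ, actB_inv_eq_self hξ, actB_inv_eq_self hη] at this
    exact this.symm
  have hl : l ≤ (w i).norm := le_norm_of_conj_eq_prefixOf (fun k => hper k) hγ
  have hl0 : 0 < l := by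
    refine Nat.pos_of_ne_zero ?_
    rintro rfl
    rw [prefixOf_zero, conj_eq_one_iff] at hγ
    exact hwi hγ
  have hle : l ≤ ∑ i, (w i).norm :=
    hl.trans (Finset.single_le_sum (f := fun i => (w i).norm) (fun _ _ => Nat.zero_le _)
      (Finset.mem_univ i))
  obtain ⟨q, hq⟩ := Nat.dvd_factorial hl0 hle
  rw [commonPeriod, hq, Nat.mul_comm]
  push_cast
  exact hper.nat_mul q

lemma IsLine.periodic_biWord (hw : ∀ i, w i ≠ 1) {ξ η : Boundary B} (h : IsLine B w ξ η)
    (h0 : ξ.1 0 ≠ η.1 0) : Function.Periodic (biWord ξ η) (commonPeriod w) := by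
  obtain ⟨g, i, hξ, hη⟩ := h.exists_conj_fixing
  have hmem : g * w i * g⁻¹ ∈ lineGeodesic B ξ η := by
    rwa [mem_lineGeodesic_iff, actB_inv_eq_self hξ, actB_inv_eq_self hη]
  obtain ⟨l, hl | hl, -⟩ := hmem
  · exact periodic_biWord_of_fixed h0 (hw i) hξ hη hl
  · exact periodic_biWord_swap (periodic_biWord_of_fixed h0.symm (hw i) hη hξ hl)

lemma IsLine.eq_of_agree (hw : ∀ i, w i ≠ 1) {ξ η ξ' η' : Boundary B}
    (h : IsLine B w ξ η) (h' : IsLine B w ξ' η') (h0 : ξ.1 0 ≠ η.1 0) (h0' : ξ'.1 0 ≠ η'.1 0)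
    (hagree : ∀ k < commonPeriod w, ξ.1 k = ξ'.1 k) : ξ = ξ' ∧ η = η' := by
  have hp := h.periodic_biWord hw h0
  have hp' := h'.periodic_biWord hw h0'
  have hpos : (0 : ℤ) < commonPeriod w := by exact_mod_cast commonPeriod_pos w
  have key : ∀ n, biWord ξ η n = biWord ξ' η' n := by
    intro n
    have e : n = n % commonPeriod w + (n / commonPeriod w : ℤ) • (commonPeriod w : ℤ) := by
      rw [smul_eq_mul, Int.emod_add_ediv_mul]
    rw [e, hp.zsmul, hp'.zsmul]
    obtain ⟨k, hk⟩ := Int.eq_ofNat_of_zero_le (Int.emod_nonneg n hpos.ne')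
    have hlt := Int.emod_lt_of_pos n hpos
    rw [hk] at hlt ⊢
    exact hagree k (by exact_mod_cast hlt)
  refine ⟨Boundary.ext_apply fun k => key k, Boundary.ext_apply fun k => ?_⟩
  have := congrArg invLetter (key (Int.negSucc k))
  simpa [biWord] using this

end Periodicity

section Support

variable [DecidableEq B]

lemma head_toWord_eq_of_mem_component {X C : Set (FreeGroup B)} (hC : IsComponentOf B X C)
    {a : FreeGroup B} (ha : a ∈ X) {u v : FreeGroup B} (hu : u ∈ C) (hv : v ∈ C) :
    (a⁻¹ * u).toWord.head? = (a⁻¹ * v).toWord.head? := by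
  obtain ⟨v₀, -, rfl⟩ := hC
  have key : ∀ u, Relation.ReflTransGen (fun a b => Adj B a b ∧ a ∉ X ∧ b ∉ X) v₀ u →
      (a⁻¹ * u).toWord.head? = (a⁻¹ * v₀).toWord.head? := by
    intro u hu
    induction hu with
    | refl => rfl
    | tail _ hstep ih =>
      obtain ⟨⟨x, rfl⟩, hb, hc⟩ := hstep
      have hne : ∀ c, c ∉ X → a⁻¹ * c ≠ 1 := by
        intro c hc h
        exact hc (inv_mul_eq_one.1 h ▸ ha)
      rw [← ih, ← mul_assoc]
      exact head_toWord_mul_letter x _ (hne _ hb) (by rw [mul_assoc]; exact hne _ hc)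
  exact (key u hu).trans (key v hv).symm

/-- Boundary points of the same component of `T ∖ X` lie in the same direction seen from any
vertex of `X`. -/
lemma direction_eq_of_mem_boundaryOf {X C : Set (FreeGroup B)} (hC : IsComponentOf B X C)
    {a : FreeGroup B} (ha : a ∈ X) {ξ ξ' : Boundary B} (hξ : ξ ∈ boundaryOf B C)
    (hξ' : ξ' ∈ boundaryOf B C) : (actB B a⁻¹ ξ).1 0 = (actB B a⁻¹ ξ').1 0 := by
  have key : ∀ ξ ∈ boundaryOf B C, ∃ u ∈ C,
      (a⁻¹ * u).toWord.head? = some ((actB B a⁻¹ ξ).1 0) := by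
    rintro ξ ⟨m, hm⟩
    obtain ⟨K, hK⟩ := tendstoBoundary_iff.1 ((tendstoBoundary_prefixOf ξ).actB a⁻¹) 1
    refine ⟨_, hm (max m K) (le_max_left _ _), ?_⟩
    rw [List.head?_eq_getElem?]
    exact hK _ (le_max_right _ _) 0 one_pos
  obtain ⟨u, hu, hu'⟩ := key ξ hξ
  obtain ⟨v, hv, hv'⟩ := key ξ' hξ'
  exact Option.some_inj.1
    (hu'.symm.trans ((head_toWord_eq_of_mem_component hC ha hu hv).trans hv'))

end Support

section Balls

/-- The ball of radius `n` about the vertex `a` of `T`. -/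
def vertexBall (a : FreeGroup B) (n : ℕ) : Set (FreeGroup B) :=
  (fun L => a * FreeGroup.mk L) '' {L : List (B × Bool) | L.length ≤ n}

lemma mem_vertexBall_self (a : FreeGroup B) (n : ℕ) : a ∈ vertexBall a n :=
  ⟨[], Nat.zero_le n, by simp [← FreeGroup.one_eq_mk]⟩

lemma finite_vertexBall [Finite B] (a : FreeGroup B) (n : ℕ) : (vertexBall a n).Finite :=
  (List.finite_length_le (B × Bool) n).image _

lemma ncard_vertexBall_le [Finite B] (a : FreeGroup B) (n : ℕ) :
    (vertexBall a n).ncard ≤ {L : List (B × Bool) | L.length ≤ n}.ncard :=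
  Set.ncard_image_le (List.finite_length_le (B × Bool) n)

lemma Adj.symm {g h : FreeGroup B} (hgh : Adj B g h) : Adj B h g := by
  obtain ⟨x, rfl⟩ := hgh
  exact ⟨invLetter x, by rw [mk_invLetter, mul_inv_cancel_right]⟩

lemma isSubtree_vertexBall (a : FreeGroup B) (n : ℕ) : IsSubtree B (vertexBall a n) := by
  let S : FreeGroup B → FreeGroup B → Prop := fun g h =>
    Adj B g h ∧ g ∈ vertexBall a n ∧ h ∈ vertexBall a n
  have : Std.Symm S := ⟨fun g h ⟨h1, h2, h3⟩ => ⟨h1.symm, h3, h2⟩⟩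
  have key : ∀ L : List (B × Bool), L.length ≤ n →
      Relation.ReflTransGen S a (a * FreeGroup.mk L) := by
    intro L
    induction L using List.reverseRecOn with
    | nil =>
      intro _
      rw [← FreeGroup.one_eq_mk, mul_one]
    | append_singleton L x ih =>
      intro hL
      rw [List.length_append, List.length_singleton] at hL
      refine (ih (by omega)).tail ⟨⟨x, ?_⟩, ⟨L, ?_, rfl⟩, ⟨L ++ [x], ?_, rfl⟩⟩
      · rw [mul_assoc, FreeGroup.mul_mk]
      · exact (by omega : L.length ≤ n)
      · simpa using hL
  rintro _ ⟨L, hL, rfl⟩ _ ⟨L', hL', rfl⟩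
  exact Relation.ReflTransGen.mono (fun _ _ h => ⟨h.1, h.2.2⟩) _ _
    ((symm (key L hL)).trans (key L' hL'))

variable [DecidableEq B]

/-- Boundary points of the same component of the complement of a ball of radius `n` about `a`
agree in their first `n + 1` letters seen from `a`. -/
lemma agree_of_mem_boundaryOf {a : FreeGroup B} {n : ℕ} {C : Set (FreeGroup B)}
    (hC : IsComponentOf B (vertexBall a n) C) {ξ ξ' : Boundary B}
    (hξ : ξ ∈ boundaryOf B C) (hξ' : ξ' ∈ boundaryOf B C) {k : ℕ} (hk : k ≤ n) :
    (actB B a⁻¹ ξ).1 k = (actB B a⁻¹ ξ').1 k := by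
  by_contra hne
  refine mem_lineGeodesic_iff.1 (prefixOf_mem_lineGeodesic le_rfl hne) ?_
  rw [← actB_mul, ← actB_mul, ← mul_inv_rev]
  exact direction_eq_of_mem_boundaryOf hC ⟨_, by simpa using hk, rfl⟩ hξ hξ'

variable {r : ℕ} {w : Fin r → FreeGroup B}

/-- A cochain vanishing on all lines that avoid the vertex `a` is supported on a ball about `a`
whose radius is a common period of the lines. -/
lemma supportedOn1_vertexBall (hw : ∀ i, w i ≠ 1) (a : FreeGroup B)
    {f : Boundary B → Boundary B → ℤ}
    (hf : ∀ ξ η, IsLine B w ξ η → a ∉ lineGeodesic B ξ η → f ξ η = 0) :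
    SupportedOn1 B w f (vertexBall a (commonPeriod w)) := by
  refine ⟨fun ξ η h hpass => hf ξ η h fun ha => hpass ⟨a, mem_vertexBall_self a _, ha⟩, ?_⟩
  intro C C' hC hC' _ ξ ξ' η η' h h' hξ hξ' hη hη'
  have key := fun k (hk : k ≤ commonPeriod w) => agree_of_mem_boundaryOf hC hξ hξ' hk
  by_cases ha : a ∈ lineGeodesic B ξ η
  · have ha' : a ∈ lineGeodesic B ξ' η' := by
      rw [mem_lineGeodesic_iff] at ha ⊢
      rwa [← key 0 (Nat.zero_le _), ← agree_of_mem_boundaryOf hC' hη hη' (Nat.zero_le _)]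
    obtain ⟨e1, e2⟩ := (h.map_actB a⁻¹).eq_of_agree hw (h'.map_actB a⁻¹)
      (mem_lineGeodesic_iff.1 ha) (mem_lineGeodesic_iff.1 ha') fun k hk => key k hk.le
    rw [← actB_actB_inv a ξ, ← actB_actB_inv a η, e1, e2, actB_actB_inv, actB_actB_inv]
  · have ha' : a ∉ lineGeodesic B ξ' η' := by
      rw [mem_lineGeodesic_iff] at ha ⊢
      rwa [← key 0 (Nat.zero_le _), ← agree_of_mem_boundaryOf hC' hη hη' (Nat.zero_le _)]
    rw [hf ξ η h ha, hf ξ' η' h' ha']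

end Balls

end DecompPaper

open DecompPaper
/-- Theorem `generators1`: there is `N`, depending only on `B` and
the words `w i`, such that every element of `C¹` is a finite `ℤ`-linear combination of
elements of `C¹` each supported on a finite nonempty subtree of `T` with at most `N`
vertices.  (Equalities between elements of `C¹` are evaluated on oriented lines.) -/
theorem first_cochains_generated_by_bounded_support
    (B : Type) [Fintype B] [DecidableEq B] (hB : 2 ≤ Fintype.card B)
    (r : ℕ) (w : Fin r → FreeGroup B) (hw : ∀ i, w i ≠ 1) (hmal : Malnormal B w) :
    ∃ N : ℕ, ∀ f : Boundary B → Boundary B → ℤ, MemC1 B w f →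
      ∃ (m : ℕ) (c : Fin m → ℤ) (F : Fin m → Boundary B → Boundary B → ℤ),
        (∀ i, Antisym B w (F i)) ∧
        (∀ i, ∃ X : Set (FreeGroup B), X.Finite ∧ X.Nonempty ∧ IsSubtree B X ∧
          X.ncard ≤ N ∧ SupportedOn1 B w (F i) X) ∧
        ∀ ξ η, IsLine B w ξ η → f ξ η = ∑ i, c i * F i ξ η := by
  classical
  refine ⟨{L : List (B × Bool) | L.length ≤ commonPeriod w}.ncard, ?_⟩
  rintro f ⟨hanti, X, hXfin, -, -, hvanish, -⟩
  -- Each line meeting `X` is assigned to one vertex of `X` on its geodesic.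
  let pick : Boundary B → Boundary B → FreeGroup B := fun ξ η =>
    if h : (X ∩ lineGeodesic B ξ η).Nonempty then h.choose else 1
  have pick_comm : ∀ ξ η, pick ξ η = pick η ξ := by
    intro ξ η
    simp only [pick, lineGeodesic_comm ξ η]
  have pick_mem : ∀ ξ η, IsLine B w ξ η → f ξ η ≠ 0 → pick ξ η ∈ X ∩ lineGeodesic B ξ η := by
    intro ξ η h hne
    have hmeet : (X ∩ lineGeodesic B ξ η).Nonempty := by
      by_contra hempty
      exact hne (hvanish ξ η h fun ⟨g, hgX, hg⟩ => hempty ⟨g, hgX, hg⟩)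
    simp only [pick, dif_pos hmeet]
    exact hmeet.choose_spec
  let e := hXfin.toFinset.equivFin
  refine ⟨hXfin.toFinset.card, fun _ => 1,
    fun j ξ η => if pick ξ η = (e.symm j : FreeGroup B) then f ξ η else 0, ?_, ?_, ?_⟩
  · intro j ξ η h
    dsimp only
    rw [pick_comm η ξ, hanti ξ η h]
    split_ifs <;> simp
  · intro j
    refine ⟨vertexBall (e.symm j : FreeGroup B) (commonPeriod w), finite_vertexBall _ _,
      ⟨_, mem_vertexBall_self _ _⟩, isSubtree_vertexBall _ _, ncard_vertexBall_le _ _,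
      supportedOn1_vertexBall hw _ fun ξ η h ha => ?_⟩
    by_contra hne
    obtain ⟨hpick, hne⟩ := ite_ne_right_iff.1 hne
    exact ha (hpick ▸ (pick_mem ξ η h hne).2)
  · intro ξ η h
    simp only [one_mul]
    by_cases hne : f ξ η = 0
    · simp [hne]
    · have hmem : pick ξ η ∈ hXfin.toFinset := hXfin.mem_toFinset.2 (pick_mem ξ η h hne).1
      rw [Finset.sum_eq_single (e ⟨_, hmem⟩)]
      · simp
      · intro j _ hj
        refine if_neg fun hpick => hj ?_
        exact (e.eq_symm_apply.1 (Subtype.ext hpick : ⟨_, hmem⟩ = e.symm j)).symm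
      · simp
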